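/- Define B_n = Σ_{j∈ℤ} (−1)^j q^{j(5j−1)/2} [2n choose n−2j]_q. Then for all n ≥ 2, B_n − (1 + q − q^n + q^{2n−1}) B_{n−1} + q(1 − q^{n−1}) B_{n−2} = 0. -/

import Mathlib

open LaurentPolynomial

/-- The Gaussian (q-)binomial coefficient `[n choose k]_q`, as a Laurent polynomial in `q`,
with the convention that it vanishes for `k < 0` or `k > n`.  Defined via the standard
Pascal-type recurrence `[n+1, k] = q^k [n, k] + [n, k-1]`. -/
noncomputable def qb : ℕ → ℤ → LaurentPolynomial ℤ
  | 0, k => if k = 0 then 1 else 0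
  | (n+1), k => T k * qb n k + qb n (k-1)

/-- The variable `q`. -/
noncomputable def q : LaurentPolynomial ℤ := T 1

/-- `B n = Σ_{j∈ℤ} (−1)^j q^{j(5j−1)/2} [2n choose n−2j]_q`. -/
noncomputable def B (n : ℕ) : LaurentPolynomial ℤ :=
  ∑ᶠ j : ℤ, (-1 : LaurentPolynomial ℤ) ^ j.natAbs * T (j * (5 * j - 1) / 2) *
    qb (2 * n) ((n : ℤ) - 2 * j)

theorem qb_succ (n : ℕ) (k : ℤ) : qb (n + 1) k = T k * qb n k + qb n (k - 1) := rfl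

/-- The dual Pascal recurrence for Gaussian binomial coefficients. -/
theorem qb_succ' (n : ℕ) (k : ℤ) :
    qb (n + 1) k = qb n k + T (n + 1 - k) * qb n (k - 1) := by
  induction n generalizing k with
  | zero =>
    rw [qb_succ]
    rcases eq_or_ne k 0 with rfl | h0
    · simp [qb]
    · rcases eq_or_ne k 1 with rfl | h1
      · simp [qb]
      · simp [qb, h0, sub_eq_zero, h1]
  | succ n ih =>
    have h : (T k * T (n + 1 - k) : LaurentPolynomial ℤ)
        = T ((n + 1 : ℕ) + 1 - k) * T (k - 1) := by
      rw [← T_add, ← T_add]; congr 1; push_cast; ring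
    have h' : ((n : ℤ) + 1 - (k - 1)) = (n + 1 : ℕ) + 1 - k := by push_cast; ring
    have e1 := ih k
    have e2 := ih (k - 1)
    rw [h'] at e2
    have s1 := qb_succ n k
    have s2 := qb_succ n (k - 1)
    rw [qb_succ (n + 1) k]
    linear_combination T k * e1 + e2 - s1 - T ((n + 1 : ℕ) + 1 - k) * s2 + h * qb n (k - 1)

/-- The contiguity relation between neighbouring Gaussian binomial coefficients. -/
theorem qb_contiguous (n : ℕ) (k : ℤ) :
    (1 - T k) * qb n k = (1 - T (n + 1 - k)) * qb n (k - 1) := by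
  linear_combination qb_succ n k - qb_succ' n k

theorem qb_symm (n : ℕ) (k : ℤ) : qb n (n - k) = qb n k := by
  induction n generalizing k with
  | zero => simp [qb]
  | succ n ih =>
    rw [qb_succ, qb_succ', ← ih k, ← ih (k - 1)]
    push_cast
    rw [show (n : ℤ) + 1 - k - 1 = n - k by ring, show (n : ℤ) + 1 - k = n - (k - 1) by ring]
    ring

theorem qb_eq_zero (n : ℕ) (k : ℤ) (h : k < 0 ∨ (n : ℤ) < k) : qb n k = 0 := by
  induction n generalizing k with
  | zero => simp only [qb]; rw [if_neg]; rintro rfl; simp at h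
  | succ n ih =>
    rw [qb_succ, ih k (by push_cast at h; omega), ih (k - 1) (by push_cast at h; omega)]
    simp

theorem finite_support_mul_qb (c : ℤ → LaurentPolynomial ℤ) (n : ℕ) (a : ℤ) :
    (Function.support fun j : ℤ => c j * qb n (a - 2 * j)).Finite := by
  refine (Set.finite_Icc (-(n + |a|) : ℤ) (n + |a|)).subset fun j hj => ?_
  by_contra h
  refine hj ?_
  dsimp only
  rw [qb_eq_zero, mul_zero]
  rw [Set.mem_Icc] at h
  rcases abs_cases a with ⟨h1, h2⟩ | ⟨h1, h2⟩ <;> rw [h1] at h <;> omega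

/-- The signed theta coefficient `(−1)^j q^{j(5j−1)/2}`. -/
noncomputable def thetaCoeff (j : ℤ) : LaurentPolynomial ℤ :=
  (-1) ^ j.natAbs * T (j * (5 * j - 1) / 2)

theorem neg_one_pow_natAbs_pred (j : ℤ) :
    (-1 : LaurentPolynomial ℤ) ^ (j - 1).natAbs = -(-1) ^ j.natAbs := by
  rcases Int.even_or_odd j with h | h
  · rw [(Int.natAbs_even.2 h).neg_one_pow,
      (Int.natAbs_odd.2 (h.sub_odd odd_one)).neg_one_pow]
  · rw [(Int.natAbs_odd.2 h).neg_one_pow,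
      (Int.natAbs_even.2 (h.sub_odd odd_one)).neg_one_pow, neg_neg]

theorem thetaCoeff_pred (j : ℤ) : thetaCoeff (j - 1) = -(T (3 - 5 * j) * thetaCoeff j) := by
  have h : (j - 1) * (5 * (j - 1) - 1) / 2 = (3 - 5 * j) + j * (5 * j - 1) / 2 := by
    rw [show (j - 1) * (5 * (j - 1) - 1) = j * (5 * j - 1) + (3 - 5 * j) * 2 by ring,
      Int.add_mul_ediv_right _ _ two_ne_zero, add_comm]
  rw [thetaCoeff, thetaCoeff, h, neg_one_pow_natAbs_pred, T_add]
  ring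

theorem thetaCoeff_neg (j : ℤ) : thetaCoeff (-j) = T j * thetaCoeff j := by
  have h : -j * (5 * -j - 1) / 2 = j + j * (5 * j - 1) / 2 := by
    rw [show -j * (5 * -j - 1) = j * (5 * j - 1) + j * 2 by ring,
      Int.add_mul_ediv_right _ _ two_ne_zero, add_comm]
  rw [thetaCoeff, thetaCoeff, h, Int.natAbs_neg, T_add]
  ring

theorem B_eq (n : ℕ) : B n = ∑ᶠ j : ℤ, thetaCoeff j * qb (2 * n) (n - 2 * j) := rfl

/-- The sum defining `B n`, symmetrized under `j ↦ -j`. -/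
theorem two_mul_B (n : ℕ) :
    2 * B n = ∑ᶠ j : ℤ, (1 + T j) * thetaCoeff j * qb (2 * n) (n - 2 * j) := by
  have h : B n = ∑ᶠ j : ℤ, (T j * thetaCoeff j) * qb (2 * n) (n - 2 * j) := by
    rw [B_eq, ← finsum_comp_equiv (Equiv.neg ℤ)]
    refine finsum_congr fun j => ?_
    rw [Equiv.neg_apply, thetaCoeff_neg, ← qb_symm]
    congr 2
    push_cast
    ring
  rw [two_mul]
  nth_rewrite 2 [h]
  rw [B_eq, ← finsum_add_distrib (finite_support_mul_qb _ _ _) (finite_support_mul_qb _ _ _)]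
  exact finsum_congr fun j => by ring

/-- The telescoping identity behind the recurrence of `B`, in an arbitrary field.  Here `x`, `y`
stand for `q ^ j`, `q ^ m`, and `b i` for `[2m choose m - 2j + i]_q`. -/
theorem certificate_identity {K : Type*} [Field K] {q x y : K} (hq : q ≠ 0) (hx : x ≠ 0)
    (b : ℤ → K)
    (h0 : (1 - y / x ^ 2) * b 0 = (1 - y * q * x ^ 2) * b (-1))
    (h1 : (1 - y / x ^ 2 / q) * b (-1) = (1 - y * q ^ 2 * x ^ 2) * b (-2))
    {e1 e2 : K}
    (he1 : e1 = y / x ^ 2 * q * (y / x ^ 2 * q * b 1 + b 0) + (y / x ^ 2 * b 0 + b (-1)))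
    (he2 : e2 =
      y / x ^ 2 * q ^ 2 *
        (y / x ^ 2 * q ^ 2 *
          (y / x ^ 2 * q ^ 2 * (y / x ^ 2 * q ^ 2 * b 2 + b 1) + (y / x ^ 2 * q * b 1 + b 0)) +
          (y / x ^ 2 * q * (y / x ^ 2 * q * b 1 + b 0) + (y / x ^ 2 * b 0 + b (-1)))) +
      (y / x ^ 2 * q *
        (y / x ^ 2 * q * (y / x ^ 2 * q * b 1 + b 0) + (y / x ^ 2 * b 0 + b (-1))) +
        (y / x ^ 2 * (y / x ^ 2 * b 0 + b (-1)) + (y / x ^ 2 / q * b (-1) + b (-2)))))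
    (g2 g1 g0 : K → K)
    (hg2 : ∀ x, g2 x = y ^ 2 * (1 + q + q ^ 2) * (x + q * x ^ 2) +
      (y ^ 2 * q ^ 3 - y ^ 3 * (q ^ 2 + q ^ 3 + q ^ 4)) * (x ^ 3 + q * x ^ 4) +
      (y ^ 2 * q ^ 4 - y ^ 3 * q ^ 5) * x ^ 5)
    (hg1 : ∀ x, g1 x = y ^ 3 * (1 + q + q ^ 2 + q ^ 3) * (x⁻¹ * q⁻¹ + 1) +
      (y ^ 3 * q ^ 2 - y ^ 2 * (1 + q) - y ^ 4 * q ^ 3) * (x + q * x ^ 2))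
    (hg0 : ∀ x, g0 x = y ^ 4 * q ^ 2 * (x⁻¹ ^ 3 + q * x⁻¹ ^ 2)) :
    (1 + x) * (e2 - (1 + q - q ^ 2 * y + q ^ 3 * y ^ 2) * e1 + q * (1 - q * y) * b 0) =
      g2 x * b (-2) + g1 x * b (-1) + g0 x * b 0 +
        q ^ 3 / x ^ 5 * (g2 (x / q) * b 0 + g1 (x / q) * b 1 + g0 (x / q) * b 2) := by
  rw [hg2, hg2, hg1, hg1, hg0, hg0, he1, he2]
  linear_combination (norm := (field_simp; ring))
    (-1 + (y ^ 2 * (1 + q + q ^ 2) - 1) * x + (y ^ 2 * (q + q ^ 2 + q ^ 3) - y * q ^ 2) * x ^ 2 +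
      (y ^ 2 * q ^ 3 - y * q ^ 2) * x ^ 3) * h1 +
    (-y * (1 + q + q ^ 2) / x ^ 2 + (y ^ 3 * q ^ 2 - y * (1 + q + q ^ 2)) / x +
      (q - y * q ^ 2 - y ^ 2 * q ^ 2 + y ^ 3 * q ^ 3) + (q - y * q ^ 2) * x) * h0

/-- The coefficient of `[2m choose m - 2j - 2]_q` in the telescoping certificate. -/
noncomputable def certCoeffTwo (m : ℕ) (j : ℤ) : LaurentPolynomial ℤ :=
  T m ^ 2 * (1 + T 1 + T 1 ^ 2) * (T j + T 1 * T j ^ 2) +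
    (T m ^ 2 * T 1 ^ 3 - T m ^ 3 * (T 1 ^ 2 + T 1 ^ 3 + T 1 ^ 4)) * (T j ^ 3 + T 1 * T j ^ 4) +
    (T m ^ 2 * T 1 ^ 4 - T m ^ 3 * T 1 ^ 5) * T j ^ 5

/-- The coefficient of `[2m choose m - 2j - 1]_q` in the telescoping certificate. -/
noncomputable def certCoeffOne (m : ℕ) (j : ℤ) : LaurentPolynomial ℤ :=
  T m ^ 3 * (1 + T 1 + T 1 ^ 2 + T 1 ^ 3) * (T (-j) * T (-1) + 1) +
    (T m ^ 3 * T 1 ^ 2 - T m ^ 2 * (1 + T 1) - T m ^ 4 * T 1 ^ 3) * (T j + T 1 * T j ^ 2)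

/-- The coefficient of `[2m choose m - 2j]_q` in the telescoping certificate. -/
noncomputable def certCoeffZero (m : ℕ) (j : ℤ) : LaurentPolynomial ℤ :=
  T m ^ 4 * T 1 ^ 2 * (T (-j) ^ 3 + T 1 * T (-j) ^ 2)

/-- The telescoping certificate for the recurrence of `B`. -/
noncomputable def certificate (m : ℕ) (j : ℤ) : LaurentPolynomial ℤ :=
  thetaCoeff j * certCoeffTwo m j * qb (2 * m) ((m - 2 : ℤ) - 2 * j) +
    thetaCoeff j * certCoeffOne m j * qb (2 * m) ((m - 1 : ℤ) - 2 * j) +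
    thetaCoeff j * certCoeffZero m j * qb (2 * m) (m - 2 * j)

theorem finite_support_certificate (m : ℕ) : (Function.support (certificate m)).Finite :=
  ((((finite_support_mul_qb _ _ _).union (finite_support_mul_qb _ _ _)).subset
    (Function.support_add _ _)).union (finite_support_mul_qb _ _ _)).subset
    (Function.support_add _ _)

/-- The summand of the symmetrized sum `2 * B n`. -/
noncomputable def summand (n : ℕ) (j : ℤ) : LaurentPolynomial ℤ :=
  (1 + T j) * thetaCoeff j * qb (2 * n) (n - 2 * j)

theorem summand_recurrence (m : ℕ) (j : ℤ) :
    summand (m + 2) j - (1 + q - q ^ (m + 2) + q ^ (2 * m + 3)) * summand (m + 1) j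
      + q * (1 - q ^ (m + 1)) * summand m j = certificate m j - certificate m (j - 1) := by
  let φ := algebraMap (LaurentPolynomial ℤ) (FractionRing (LaurentPolynomial ℤ))
  have hφ : Function.Injective φ := IsFractionRing.injective _ _
  obtain ⟨u, hu⟩ : ∃ u, φ (T 1) = u := ⟨_, rfl⟩
  have hu0 : u ≠ 0 := by
    rw [← hu, Ne, map_eq_zero_iff φ hφ]
    exact (isUnit_T 1).ne_zero
  have hnat (k : ℕ) : φ (T k) = u ^ k := by rw [← hu, ← map_pow, T_pow, mul_one]
  have hT (k : ℤ) : φ (T k) = u ^ k := by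
    obtain ⟨k, rfl | rfl⟩ := k.eq_nat_or_neg
    · rw [hnat, zpow_natCast]
    · rw [zpow_neg, zpow_natCast, ← hnat]
      refine eq_inv_of_mul_eq_one_left ?_
      rw [← map_mul, ← T_add, neg_add_cancel, T_zero, map_one]
  obtain ⟨x, hx⟩ : ∃ x, u ^ j = x := ⟨_, rfl⟩
  obtain ⟨y, hy⟩ : ∃ y, u ^ m = y := ⟨_, rfl⟩
  have hx0 : x ≠ 0 := hx ▸ zpow_ne_zero _ hu0
  obtain ⟨b, hb⟩ : ∃ b : ℤ → FractionRing (LaurentPolynomial ℤ),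
      ∀ i, φ (qb (2 * m) (m - 2 * j + i)) = b i := ⟨_, fun _ => rfl⟩
  have hk (i : ℤ) : φ (T (m - 2 * j + i)) = y / x ^ 2 * u ^ i := by
    rw [hT, zpow_add₀ hu0, zpow_sub₀ hu0, zpow_natCast, hy, mul_comm 2 j, zpow_mul, hx]
    rfl
  have hk' (i : ℤ) : φ (T ((2 * m : ℕ) + 1 - (m - 2 * j + i))) = y * x ^ 2 * u ^ (1 - i) := by
    rw [show ((2 * m : ℕ) + 1 - (m - 2 * j + i) : ℤ) = m + j * 2 + (1 - i) by push_cast; ring,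
      hT, zpow_add₀ hu0, zpow_add₀ hu0, zpow_natCast, hy, zpow_mul, hx]
    rfl
  have hcont (i : ℤ) :
      (1 - y / x ^ 2 * u ^ i) * b i = (1 - y * x ^ 2 * u ^ (1 - i)) * b (i - 1) := by
    have := congrArg φ (qb_contiguous (2 * m) (m - 2 * j + i))
    rw [add_sub_assoc ((m : ℤ) - 2 * j) i 1] at this
    simpa only [map_mul, map_sub, map_one, hk, hk', hb] using this
  have hpas (n : ℕ) (i : ℤ) : φ (qb (n + 1) (m - 2 * j + i)) =
      y / x ^ 2 * u ^ i * φ (qb n (m - 2 * j + i)) + φ (qb n (m - 2 * j + (i - 1))) := by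
    rw [qb_succ, map_add, map_mul, hk, add_sub_assoc]
  have hb0 : φ (qb (2 * m) (m - 2 * j)) = b 0 := by rw [← hb, add_zero]
  have i1 : ((m + 1 : ℕ) : ℤ) - 2 * j = m - 2 * j + 1 := by push_cast; ring
  have i2 : ((m + 2 : ℕ) : ℤ) - 2 * j = m - 2 * j + 2 := by push_cast; ring
  have key := certificate_identity hu0 hx0 b
    (by simpa [mul_right_comm] using hcont 0)
    (by simpa [mul_right_comm, div_eq_mul_inv] using hcont (-1))
    (e1 := φ (qb (2 * (m + 1)) ((m + 1 : ℕ) - 2 * j)))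
    (e2 := φ (qb (2 * (m + 2)) ((m + 2 : ℕ) - 2 * j)))
    (by
      rw [i1, show 2 * (m + 1) = 2 * m + 1 + 1 by ring]
      simp only [hpas, hb]
      norm_num)
    (by
      rw [i2, show 2 * (m + 2) = 2 * m + 1 + 1 + 1 + 1 by ring]
      simp only [hpas, hb]
      norm_num [div_eq_mul_inv])
    _ _ _ (fun _ => rfl) (fun _ => rfl) (fun _ => rfl)
  apply hφ
  have hpred : u ^ (j - 1) = x / u := by rw [zpow_sub_one₀ hu0, hx, div_eq_mul_inv]
  have h3 : φ (T (3 - 5 * j)) = u ^ 3 / x ^ 5 := by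
    rw [hT, zpow_sub₀ hu0, mul_comm 5 j, zpow_mul, hx]; rfl
  have j2 : (m : ℤ) - 2 - 2 * j = m - 2 * j + -2 := by ring
  have j1 : (m : ℤ) - 1 - 2 * j = m - 2 * j + -1 := by ring
  have j2' : (m : ℤ) - 2 - 2 * (j - 1) = m - 2 * j + 0 := by ring
  have j1' : (m : ℤ) - 1 - 2 * (j - 1) = m - 2 * j + 1 := by ring
  have j0' : (m : ℤ) - 2 * (j - 1) = m - 2 * j + 2 := by ring
  have hm2 : u ^ (m + 2) = u ^ 2 * y := by rw [pow_add, hy, mul_comm]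
  have hm1 : u ^ (m + 1) = u * y := by rw [pow_succ, hy, mul_comm]
  have hm3 : u ^ (2 * m + 3) = u ^ 3 * y ^ 2 := by
    rw [pow_add, mul_comm 2 m, pow_mul, hy, mul_comm]
  change φ _ = φ _
  simp only [summand, certificate, certCoeffTwo, certCoeffOne, certCoeffZero, thetaCoeff_pred,
    q, map_add, map_sub, map_mul, map_neg, map_one, map_pow, h3, j2, j1, j2', j1', j0', hu]
  simp only [hb, hb0, hT, zpow_neg, hpred, hx, zpow_natCast, hy, hm1, hm2, hm3, zpow_one]
  linear_combination φ (thetaCoeff j) * key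

theorem stmt2 (n : ℕ) (hn : 2 ≤ n) :
    B n - (1 + q - q ^ n + q ^ (2 * n - 1)) * B (n - 1)
      + q * (1 - q ^ (n - 1)) * B (n - 2) = 0 := by
  obtain ⟨m, rfl⟩ := Nat.exists_eq_add_of_le' hn
  rw [show 2 * (m + 2) - 1 = 2 * m + 3 by omega, show m + 2 - 1 = m + 1 by omega,
    Nat.add_sub_cancel]
  have h2 : (2 : LaurentPolynomial ℤ) ≠ 0 := by
    rw [← map_ofNat (Polynomial.toLaurent (R := ℤ)) 2]
    exact Polynomial.toLaurent_ne_zero.2 two_ne_zero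
  refine (mul_eq_zero.1 ?_).resolve_left h2
  have hfin (n : ℕ) : (Function.support (summand n)).Finite := finite_support_mul_qb _ _ _
  have hB (n : ℕ) : 2 * B n = ∑ᶠ j, summand n j := two_mul_B n
  have hmul (c : LaurentPolynomial ℤ) (n : ℕ) :
      (Function.support fun j => c * summand n j).Finite :=
    (hfin n).subset (Function.support_mul_subset_right _ _)
  have hshift : ∑ᶠ j, certificate m (j - 1) = ∑ᶠ j, certificate m j :=
    finsum_comp_equiv (Equiv.subRight (1 : ℤ))
  have hshiftfin : (Function.support fun j => certificate m (j - 1)).Finite :=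
    (finite_support_certificate m).preimage (Equiv.subRight (1 : ℤ)).injective.injOn
  have hsum := finsum_congr (summand_recurrence m)
  rw [finsum_sub_distrib (finite_support_certificate m) hshiftfin, hshift, sub_self,
    finsum_add_distrib (((hfin _).union (hmul _ _)).subset (Function.support_sub _ _)) (hmul _ _),
    finsum_sub_distrib (hfin _) (hmul _ _), ← mul_finsum, ← mul_finsum,
    ← hB, ← hB, ← hB] at hsum
  linear_combination hsum
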